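/- arXiv:1907.03851 — 2 statements merged into one kernel-verified Lean document; each statement's English description precedes it below -/
import Mathlib

section
/- Let (X, φ) be a minimal dynamical system with X an infinite compact metric space, and let Y ⊆ X be a nonempty closed subset meeting every orbit at most once. Then for every integer n, the set {x ∈ X : (x, φⁿ(x)) ∉ R_Y} is closed in X; explicitly, for n ≥ 1 it equals the finite union ⋃_{k=1−n}^{0} φᵏ(Y), for n ≤ −1 it equals ⋃_{k=1}^{−n} φᵏ(Y), and for n = 0 it is empty. Consequently R_Y is an open subset of R_φ when R_φ is given the topology transported from the product topology on X × ℤ (ℤ discrete) via the bijection (x, n) ↦ (x, φⁿ(x)). -/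
/-- The orbit equivalence relation `R_φ = {(x, φⁿ x) : x ∈ X, n ∈ ℤ}` of a homeomorphism. -/
def orbitRel {X : Type*} [TopologicalSpace X] (φ : X ≃ₜ X) : Set (X × X) :=
  {p : X × X | ∃ n : ℤ, (φ.toEquiv ^ n) p.1 = p.2}

/-- The orbit-breaking relation
`R_Y = R_φ \ {(φᵏ y, φˡ y) : y ∈ Y, (l < 1 ≤ k or k < 1 ≤ l)}`. -/
def orbitBreakRel {X : Type*} [TopologicalSpace X] (φ : X ≃ₜ X) (Y : Set X) : Set (X × X) :=
  orbitRel φ \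
    {p : X × X | ∃ y ∈ Y, ∃ k l : ℤ,
      ((l < 1 ∧ 1 ≤ k) ∨ (k < 1 ∧ 1 ≤ l)) ∧
      p = ((φ.toEquiv ^ k) y, (φ.toEquiv ^ l) y)}

/-- A minimal homeomorphism of an infinite T1 space is free. -/
theorem zpow_apply_injective_of_dense {X : Type*} [TopologicalSpace X] [T1Space X] [Infinite X]
    (φ : X ≃ₜ X) (hmin : ∀ x : X, Dense (Set.range fun n : ℤ => (φ.toEquiv ^ n) x)) (x : X) :
    Function.Injective fun n : ℤ => (φ.toEquiv ^ n) x := by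
  have no_period : ∀ d : ℤ, (φ.toEquiv ^ d) x = x → d = 0 := by
    intro d hd
    by_contra hne
    have hsub : Set.range (fun n : ℤ => (φ.toEquiv ^ n) x) ⊆
        (fun n : ℤ => (φ.toEquiv ^ n) x) '' Set.Ico 0 |d| := by
      rintro _ ⟨n, rfl⟩
      refine ⟨n % d, ⟨Int.emod_nonneg n hne, Int.emod_lt_abs n hne⟩, ?_⟩
      have hq : (φ.toEquiv ^ (d * (n / d))) x = x := by
        rw [zpow_mul]
        exact Equiv.Perm.zpow_apply_eq_self_of_apply_eq_self hd _
      have hn : (φ.toEquiv ^ n) x = (φ.toEquiv ^ (n % d + d * (n / d))) x := by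
        rw [Int.emod_add_mul_ediv]
      simp only [hn, zpow_add, Equiv.Perm.mul_apply, hq]
    have hfin := ((Set.finite_Ico (0 : ℤ) |d|).image _).subset hsub
    have huniv := (hmin x).closure_eq
    rw [hfin.isClosed.closure_eq] at huniv
    exact Set.infinite_univ (huniv ▸ hfin)
  intro k l hkl
  have hsub : (φ.toEquiv ^ (-l + k)) x = x := by
    have hkl' : (φ.toEquiv ^ k) x = (φ.toEquiv ^ l) x := hkl
    rw [zpow_add, Equiv.Perm.mul_apply, hkl', ← Equiv.Perm.mul_apply, ← zpow_add]
    simp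
  have := no_period _ hsub
  omega

theorem continuous_toEquiv_zpow {X : Type*} [TopologicalSpace X] (φ : X ≃ₜ X) (k : ℤ) :
    Continuous ⇑(φ.toEquiv ^ k) := by
  induction k with
  | zero => simpa using continuous_id
  | succ i ih =>
    rw [zpow_add_one, Equiv.Perm.coe_mul]
    exact ih.comp φ.continuous
  | pred i ih =>
    rw [zpow_sub_one, Equiv.Perm.coe_mul]
    exact ih.comp φ.symm.continuous

/-- The pairs `(x, φⁿ x)` removed from `R_φ`, when `φ` is free. -/
theorem setOf_notMem_orbitBreakRel {X : Type*} [TopologicalSpace X] (φ : X ≃ₜ X)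
    (hfree : ∀ x : X, Function.Injective fun n : ℤ => (φ.toEquiv ^ n) x) (Y : Set X) (n : ℤ) :
    {x : X | (x, (φ.toEquiv ^ n) x) ∉ orbitBreakRel φ Y} =
      ⋃ k ∈ {k : ℤ | (n + k < 1 ∧ 1 ≤ k) ∨ (k < 1 ∧ 1 ≤ n + k)}, ⇑(φ.toEquiv ^ k) '' Y := by
  ext x
  simp only [orbitBreakRel, orbitRel, Set.mem_ofPred_eq, Set.mem_sdiff, Set.mem_iUnion,
    Set.mem_image, exists_prop, Prod.mk.injEq, not_and, not_not]
  constructor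
  · intro h
    obtain ⟨y, hy, k, l, hkl, hx, hl⟩ := h ⟨n, rfl⟩
    have hnk : n + k = l := by
      apply hfree y
      simp only [zpow_add, Equiv.Perm.mul_apply, ← hx, hl]
    exact ⟨k, hnk ▸ hkl, y, hy, hx.symm⟩
  · rintro ⟨k, hk, y, hy, rfl⟩ -
    exact ⟨y, hy, k, n + k, hk, rfl, by rw [zpow_add, Equiv.Perm.mul_apply]⟩

theorem isClosed_setOf_notMem_orbitBreakRel {X : Type*} [TopologicalSpace X] [T2Space X]
    [CompactSpace X] (φ : X ≃ₜ X)
    (hfree : ∀ x : X, Function.Injective fun n : ℤ => (φ.toEquiv ^ n) x)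
    {Y : Set X} (hYcl : IsClosed Y) (n : ℤ) :
    IsClosed {x : X | (x, (φ.toEquiv ^ n) x) ∉ orbitBreakRel φ Y} := by
  rw [setOf_notMem_orbitBreakRel φ hfree]
  refine Set.Finite.isClosed_biUnion ?_ fun k _ =>
    (hYcl.isCompact.image (continuous_toEquiv_zpow φ k)).isClosed
  refine (Set.finite_Icc (-|n|) |n|).subset fun k hk => ?_
  simp only [Set.mem_ofPred_eq, Set.mem_Icc] at hk ⊢
  grind

/-- Let `(X, φ)` be a minimal dynamical system with `X` an infinite compact
metric space, and `Y ⊆ X` a nonempty closed subset meeting every orbit at most once.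
For every `n : ℤ` the set `{x : (x, φⁿ x) ∉ R_Y}` is closed; explicitly, for `n ≥ 1` it
equals `⋃_{k = 1-n}^{0} φᵏ(Y)`, for `n ≤ -1` it equals `⋃_{k=1}^{-n} φᵏ(Y)`, and for
`n = 0` it is empty.  Consequently `R_Y` is open in `R_φ` with the topology transported
from `X × ℤ` via the bijection `(x, n) ↦ (x, φⁿ x)`: the preimage of `R_Y` under this
map is open in `X × ℤ`. -/
theorem orbitBreakRel_open {X : Type*} [MetricSpace X] [CompactSpace X] [Infinite X]
    (φ : X ≃ₜ X)
    (hmin : ∀ x : X, Dense (Set.range fun n : ℤ => (φ.toEquiv ^ n) x))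
    (Y : Set X) (hYne : Y.Nonempty) (hYcl : IsClosed Y)
    (hY : ∀ n : ℤ, n ≠ 0 → (⇑(φ.toEquiv ^ n) '' Y) ∩ Y = ∅) :
    (∀ n : ℤ,
      IsClosed {x : X | (x, (φ.toEquiv ^ n) x) ∉ orbitBreakRel φ Y} ∧
      (1 ≤ n → {x : X | (x, (φ.toEquiv ^ n) x) ∉ orbitBreakRel φ Y} =
        ⋃ k ∈ Set.Icc (1 - n) (0 : ℤ), ⇑(φ.toEquiv ^ k) '' Y) ∧
      (n ≤ -1 → {x : X | (x, (φ.toEquiv ^ n) x) ∉ orbitBreakRel φ Y} =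
        ⋃ k ∈ Set.Icc (1 : ℤ) (-n), ⇑(φ.toEquiv ^ k) '' Y) ∧
      (n = 0 → {x : X | (x, (φ.toEquiv ^ n) x) ∉ orbitBreakRel φ Y} = ∅)) ∧
    IsOpen {p : X × ℤ | (p.1, (φ.toEquiv ^ p.2) p.1) ∈ orbitBreakRel φ Y} := by
  have hfree := zpow_apply_injective_of_dense φ hmin
  have hclosed := isClosed_setOf_notMem_orbitBreakRel φ hfree hYcl
  refine ⟨fun n => ⟨hclosed n, fun hn => ?_, fun hn => ?_, fun hn => ?_⟩, ?_⟩
  · rw [setOf_notMem_orbitBreakRel φ hfree]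
    congr! 3 with k
    simp only [Set.mem_ofPred_eq, Set.mem_Icc]
    omega
  · rw [setOf_notMem_orbitBreakRel φ hfree]
    congr! 3 with k
    simp only [Set.mem_ofPred_eq, Set.mem_Icc]
    omega
  · rw [setOf_notMem_orbitBreakRel φ hfree]
    simp only [Set.iUnion_eq_empty, Set.mem_ofPred_eq]
    intro k hk
    omega
  · have hslices : {p : X × ℤ | (p.1, (φ.toEquiv ^ p.2) p.1) ∈ orbitBreakRel φ Y} =
        ⋃ n : ℤ, {x : X | (x, (φ.toEquiv ^ n) x) ∉ orbitBreakRel φ Y}ᶜ ×ˢ {n} := by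
      ext ⟨x, n⟩
      simp
    rw [hslices]
    exact isOpen_iUnion fun n => (hclosed n).isOpen_compl.prod (isOpen_discrete _)
end

section
/- Let (X, d) be a compact metric space, 𝒰 a finite open cover of X, and c > 0 a real number. Then the set {α ∈ Homeo(X) : inf_{n≥1} 𝒟(𝒰, α, n)/n < c} is open in Homeo(X) with respect to the metric ρ. -/
/-- The metric `ρ(g,h) = sup_x d(g x, h x) + sup_x d(g⁻¹ x, h⁻¹ x)` on `Homeo(X)`. -/
noncomputable def homeoDist {X : Type*} [MetricSpace X] (g h : X ≃ₜ X) : ℝ :=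
  (⨆ x : X, dist (g x) (h x)) + (⨆ x : X, dist (g.symm x) (h.symm x))

-- The order of a finite cover: `ord(𝒰) = max_x Σ_{U ∈ 𝒰} χ_U(x) − 1`.
open Classical in
noncomputable def coverOrd {X : Type*} (U : Finset (Set X)) : ℕ :=
  ⨆ x : X, ((U.filter fun u => x ∈ u).card - 1)

/-- `𝒟(𝒰)`: the minimal order of a finite open cover refining `𝒰`. -/
noncomputable def coverD {X : Type*} [TopologicalSpace X] (U : Set (Set X)) : ℕ :=
  sInf {m : ℕ | ∃ V : Finset (Set X), (∀ v ∈ V, IsOpen v) ∧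
    ⋃₀ (V : Set (Set X)) = Set.univ ∧ (∀ v ∈ V, ∃ u ∈ U, v ⊆ u) ∧ coverOrd V = m}

/-- The join `𝒰 ∨ α⁻¹(𝒰) ∨ ⋯ ∨ α^{-n+1}(𝒰)`: its members are the sets
`⋂_{r=0}^{n-1} α^{-r}(U_r)` with each `U_r ∈ 𝒰`. -/
def joinCover {X : Type*} [TopologicalSpace X] (U : Set (Set X)) (α : X ≃ₜ X) (n : ℕ) :
    Set (Set X) :=
  {V : Set X | ∃ f : Fin n → Set X, (∀ r, f r ∈ U) ∧
    V = ⋂ r : Fin n, ⇑(α.toEquiv ^ (r : ℕ)) ⁻¹' f r}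

/-- `𝒟(𝒰, α, n) = 𝒟(𝒰 ∨ α⁻¹(𝒰) ∨ ⋯ ∨ α^{-n+1}(𝒰))`. -/
noncomputable def coverDn {X : Type*} [TopologicalSpace X] (U : Set (Set X)) (α : X ≃ₜ X)
    (n : ℕ) : ℕ :=
  coverD (joinCover U α n)

/-- The mean dimension `mdim(α) = sup_𝒰 inf_{n ≥ 1} 𝒟(𝒰, α, n)/n`, the supremum over all
finite open covers `𝒰` of `X`. -/
noncomputable def mdim {X : Type*} [TopologicalSpace X] (α : X ≃ₜ X) : ENNReal :=
  ⨆ U ∈ {U : Finset (Set X) | (∀ u ∈ U, IsOpen u) ∧ ⋃₀ (U : Set (Set X)) = Set.univ},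
    ⨅ n : ℕ, (coverDn (↑U) α (n + 1) : ENNReal) / ((n : ENNReal) + 1)

open Filter Topology in
/-- If `F i → f` uniformly and `f` is uniformly continuous, then the iterates of `F i` converge
uniformly to those of `f`. -/
theorem TendstoUniformly.iterate_of_uniformContinuous {ι X : Type*} [PseudoMetricSpace X]
    {l : Filter ι} {F : ι → X → X} {f : X → X} (h : TendstoUniformly F f l)
    (hf : UniformContinuous f) (r : ℕ) :
    TendstoUniformly (fun i => (F i)^[r]) (f^[r]) l := by
  induction r with
  | zero =>
    rw [Metric.tendstoUniformly_iff]
    intro ε hε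
    exact Eventually.of_forall fun i x => by simpa using hε
  | succ r ih =>
    rw [Metric.tendstoUniformly_iff] at h ih ⊢
    intro ε hε
    obtain ⟨η, hη, hfη⟩ := Metric.uniformContinuous_iff.1 hf (ε / 2) (half_pos hε)
    filter_upwards [h (ε / 2) (half_pos hε), ih η hη] with i h₁ h₂ x
    rw [Function.iterate_succ_apply', Function.iterate_succ_apply']
    calc dist (f (f^[r] x)) (F i ((F i)^[r] x))
        ≤ dist (f (f^[r] x)) (f ((F i)^[r] x)) + dist (f ((F i)^[r] x)) (F i ((F i)^[r] x)) :=
          dist_triangle _ _ _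
      _ < ε / 2 + ε / 2 := add_lt_add (hfη (h₂ x)) (h₁ _)
      _ = ε := add_halves ε

theorem homeoDist_nonneg {X : Type*} [MetricSpace X] (g h : X ≃ₜ X) : 0 ≤ homeoDist g h :=
  add_nonneg (Real.iSup_nonneg fun _ => dist_nonneg) (Real.iSup_nonneg fun _ => dist_nonneg)

theorem dist_apply_le_homeoDist {X : Type*} [MetricSpace X] [CompactSpace X] (g h : X ≃ₜ X)
    (x : X) : dist (g x) (h x) ≤ homeoDist g h := by
  have hb : BddAbove (Set.range fun x : X => dist (g x) (h x)) :=
    (isCompact_range (g.continuous.dist h.continuous)).bddAbove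
  exact (le_ciSup hb x).trans
    (le_add_of_nonneg_right (Real.iSup_nonneg fun _ => dist_nonneg))

open Filter Topology in
theorem tendstoUniformly_of_homeoDist {X : Type*} [MetricSpace X] [CompactSpace X] (α : X ≃ₜ X) :
    TendstoUniformly (fun (β : X ≃ₜ X) (x : X) => β x) α (comap (homeoDist α) (𝓝 0)) := by
  rw [Metric.tendstoUniformly_iff]
  intro ε hε
  filter_upwards [tendsto_comap.eventually (gt_mem_nhds hε)] with β hβ x
  exact (dist_apply_le_homeoDist α β x).trans_lt hβ

theorem finite_joinCover {X : Type*} [TopologicalSpace X] {U : Set (Set X)} (hU : U.Finite)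
    (α : X ≃ₜ X) (n : ℕ) : (joinCover U α n).Finite := by
  refine ((Set.Finite.pi' fun _ : Fin n => hU).image
    fun f => ⋂ r : Fin n, ⇑(α.toEquiv ^ (r : ℕ)) ⁻¹' f r).subset ?_
  rintro V ⟨f, hf, rfl⟩
  exact ⟨f, hf, rfl⟩

theorem continuous_toEquiv_pow {X : Type*} [TopologicalSpace X] (α : X ≃ₜ X) (r : ℕ) :
    Continuous ⇑(α.toEquiv ^ r) := by
  rw [← Equiv.Perm.iterate_eq_pow]
  exact α.continuous.iterate r

theorem isOpen_of_mem_joinCover {X : Type*} [TopologicalSpace X] {U : Set (Set X)}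
    (hU : ∀ u ∈ U, IsOpen u) {α : X ≃ₜ X} {n : ℕ} {V : Set X} (hV : V ∈ joinCover U α n) :
    IsOpen V := by
  obtain ⟨f, hf, rfl⟩ := hV
  exact isOpen_iInter_of_finite fun r => (hU _ (hf r)).preimage (continuous_toEquiv_pow α r)

theorem sUnion_joinCover {X : Type*} [TopologicalSpace X] {U : Set (Set X)}
    (hU : ⋃₀ U = Set.univ) (α : X ≃ₜ X) (n : ℕ) : ⋃₀ joinCover U α n = Set.univ := by
  refine Set.eq_univ_of_forall fun x => ?_
  have hx : ∀ r : Fin n, ∃ u ∈ U, (α.toEquiv ^ (r : ℕ)) x ∈ u := fun r =>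
    Set.mem_sUnion.1 (hU ▸ Set.mem_univ _)
  choose f hfU hf using hx
  exact ⟨_, ⟨f, hfU, rfl⟩, Set.mem_iInter.2 hf⟩

/-- The infimum defining `𝒟(𝒰)` is attained for a finite open cover `𝒰`. -/
theorem exists_coverOrd_eq_coverD {X : Type*} [TopologicalSpace X] {U : Set (Set X)}
    (hfin : U.Finite) (hUo : ∀ u ∈ U, IsOpen u) (hUc : ⋃₀ U = Set.univ) :
    ∃ V : Finset (Set X), (∀ v ∈ V, IsOpen v) ∧ ⋃₀ (V : Set (Set X)) = Set.univ ∧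
      (∀ v ∈ V, ∃ u ∈ U, v ⊆ u) ∧ coverOrd V = coverD U :=
  Nat.sInf_mem (s := {m : ℕ | ∃ V : Finset (Set X), (∀ v ∈ V, IsOpen v) ∧
    ⋃₀ (V : Set (Set X)) = Set.univ ∧ (∀ v ∈ V, ∃ u ∈ U, v ⊆ u) ∧ coverOrd V = m})
    ⟨_, hfin.toFinset, by simpa using hUo, by simpa using hUc,
      fun v hv => ⟨v, by simpa using hv, subset_rfl⟩, rfl⟩

open Classical in
/-- Shrinking the members of a finite family does not increase its order. -/
theorem coverOrd_image_le {X : Type*} (V : Finset (Set X)) (w : Set X → Set X)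
    (hw : ∀ v ∈ V, w v ⊆ v) : coverOrd (V.image w) ≤ coverOrd V := by
  refine ciSup_mono ⟨V.card, ?_⟩ fun x => Nat.sub_le_sub_right ?_ 1
  · rintro _ ⟨x, rfl⟩
    exact (Nat.sub_le _ _).trans (Finset.card_filter_le _ _)
  · rw [Finset.filter_image]
    refine Finset.card_image_le.trans (Finset.card_le_card fun v hv => ?_)
    rw [Finset.mem_filter] at hv ⊢
    exact ⟨hv.1, hw v hv.1 hv.2⟩

/-- A finite open cover of a normal space can be shrunk to an open cover whose members have
closures inside the original members. -/
theorem exists_open_shrinking {X : Type*} [TopologicalSpace X] [NormalSpace X]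
    (V : Finset (Set X)) (hVo : ∀ v ∈ V, IsOpen v) (hVc : ⋃₀ (V : Set (Set X)) = Set.univ) :
    ∃ w : Set X → Set X, (∀ v ∈ V, IsOpen (w v)) ∧ (⋃ v ∈ V, w v) = Set.univ ∧
      ∀ v ∈ V, closure (w v) ⊆ v := by
  classical
  obtain ⟨w, hwc, hwo, hw⟩ := exists_iUnion_eq_closure_subset
    (u := fun v : V => (v : Set X)) (fun v => hVo v v.2) (fun _ => Set.toFinite _)
    (by simpa [Set.sUnion_eq_iUnion] using hVc)
  refine ⟨fun v => if h : v ∈ V then w ⟨v, h⟩ else ∅, fun v hv => ?_, ?_, fun v hv => ?_⟩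
  · simpa [hv] using hwo ⟨v, hv⟩
  · refine Set.eq_univ_of_forall fun x => ?_
    obtain ⟨v, hv⟩ := Set.mem_iUnion.1 (hwc ▸ Set.mem_univ x)
    exact Set.mem_biUnion v.2 (by simpa using hv)
  · simpa [hv] using hw ⟨v, hv⟩

open Filter Topology in
/-- The quantity `𝒟(𝒰, α, n)` is upper semicontinuous in `α`. -/
theorem eventually_coverDn_le {X : Type*} [MetricSpace X] [CompactSpace X]
    (U : Finset (Set X)) (hUo : ∀ u ∈ U, IsOpen u) (hUc : ⋃₀ (U : Set (Set X)) = Set.univ)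
    (α : X ≃ₜ X) (n : ℕ) :
    ∀ᶠ β : X ≃ₜ X in comap (homeoDist α) (𝓝 0), coverDn (↑U) β n ≤ coverDn (↑U) α n := by
  classical
  obtain ⟨V, hVo, hVc, hVU, hVD⟩ := exists_coverOrd_eq_coverD
    (finite_joinCover U.finite_toSet α n) (fun _ => isOpen_of_mem_joinCover hUo)
    (sUnion_joinCover hUc α n)
  obtain ⟨w, hwo, hwc, hw⟩ := exists_open_shrinking V hVo hVc
  have key : ∀ v ∈ V, ∀ᶠ β : X ≃ₜ X in comap (homeoDist α) (𝓝 0),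
      ∃ u ∈ joinCover (U : Set (Set X)) β n, w v ⊆ u := by
    intro v hv
    obtain ⟨_, ⟨f, hf, rfl⟩, hvf⟩ := hVU v hv
    have hr : ∀ r : Fin n, ∀ᶠ β : X ≃ₜ X in comap (homeoDist α) (𝓝 0),
        w v ⊆ ⇑(β.toEquiv ^ (r : ℕ)) ⁻¹' f r := by
      intro r
      have hc : IsCompact (⇑(α.toEquiv ^ (r : ℕ)) '' closure (w v)) :=
        isClosed_closure.isCompact.image (continuous_toEquiv_pow α r)
      obtain ⟨ε, hε, hεf⟩ := hc.exists_thickening_subset_open (hUo _ (hf r))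
        (Set.image_subset_iff.2 fun x hx => Set.mem_iInter.1 (hvf (hw v hv hx)) r)
      have hunif := (tendstoUniformly_of_homeoDist α).iterate_of_uniformContinuous
        (CompactSpace.uniformContinuous_of_continuous α.continuous) r
      filter_upwards [Metric.tendstoUniformly_iff.1 hunif ε hε] with β hβ x hx
      refine hεf (Metric.mem_thickening_iff.2
        ⟨_, Set.mem_image_of_mem _ (subset_closure hx), ?_⟩)
      rw [dist_comm, ← Equiv.Perm.iterate_eq_pow, ← Equiv.Perm.iterate_eq_pow]
      exact hβ x
    filter_upwards [eventually_all.2 hr] with β hβ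
    exact ⟨_, ⟨f, hf, rfl⟩, Set.subset_iInter hβ⟩
  filter_upwards [(eventually_all_finset V).2 key] with β hβ
  refine (Nat.sInf_le ⟨V.image w, ?_, ?_, ?_, rfl⟩ : coverD _ ≤ coverOrd (V.image w)).trans
    ((coverOrd_image_le V w fun v hv => subset_closure.trans (hw v hv)).trans_eq hVD)
  · simpa using hwo
  · simpa using hwc
  · simpa using hβ

/-- Let `(X, d)` be a compact metric space, `𝒰` a finite open cover of `X`,
and `c > 0`.  Then the set `{α ∈ Homeo(X) : inf_{n ≥ 1} 𝒟(𝒰, α, n)/n < c}` is open in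
`Homeo(X)` with respect to the metric `ρ`. -/
theorem mean_dim_quantity_lt_open {X : Type*} [MetricSpace X] [CompactSpace X]
    (U : Finset (Set X)) (hUo : ∀ u ∈ U, IsOpen u) (hUc : ⋃₀ (U : Set (Set X)) = Set.univ)
    (c : ℝ) (hc : 0 < c) :
    ∀ α : X ≃ₜ X,
      (⨅ n : ℕ, (coverDn (↑U) α (n + 1) : ℝ) / ((n : ℝ) + 1)) < c →
      ∃ δ > 0, ∀ β : X ≃ₜ X, homeoDist α β < δ →
        (⨅ n : ℕ, (coverDn (↑U) β (n + 1) : ℝ) / ((n : ℝ) + 1)) < c := by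
  intro α hα
  obtain ⟨n, hn⟩ := exists_lt_of_ciInf_lt hα
  obtain ⟨δ, hδ, h⟩ := ((Metric.nhds_basis_ball (x := (0 : ℝ))).comap (homeoDist α)).eventually_iff.1
    (eventually_coverDn_le U hUo hUc α (n + 1))
  refine ⟨δ, hδ, fun β hβ => ?_⟩
  have hle : coverDn (↑U) β (n + 1) ≤ coverDn (↑U) α (n + 1) :=
    h (by simpa [abs_of_nonneg (homeoDist_nonneg α β)] using hβ)
  have hb : BddBelow (Set.range fun n : ℕ => (coverDn (↑U) β (n + 1) : ℝ) / ((n : ℝ) + 1)) :=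
    ⟨0, by rintro _ ⟨m, rfl⟩; positivity⟩
  refine (ciInf_le hb n).trans_lt (lt_of_le_of_lt ?_ hn)
  gcongr
end
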